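/- Let R be a ℤ-graded ring whose degree-zero component R₀ is commutative, and let M be a ℤ-graded left R-module. Fix an integer k and suppose the degree-k component M_k (an R₀-module) decomposes as a direct sum M_k = T ⊕ N of R₀-submodules, where T is precisely the R₀-torsion submodule of M_k (the elements annihilated by some non-zero-divisor of R₀) and N is a complementary R₀-submodule. Assume that for every x ∈ N and every y ∈ T there exist an integer d and a homogeneous element z ∈ R of degree d such that (i) z • x′ = 0 for every x′ ∈ N, and (ii) multiplication by z is injective on the cyclic R₀-submodule R₀ • y of M_k (i.e., for t ∈ R₀ • y, z • t = 0 implies t = 0). Then every grading-preserving R-linear map F : M → M (i.e., F(M_j) ⊆ M_j for all j ∈ ℤ) preserves the decomposition in degree k: F(T) ⊆ T and F(N) ⊆ N. -/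

import Mathlib

/--
Let `R` be a ℤ-graded ring (grading `𝒜`) whose degree-zero component is commutative, and
let `M` be a ℤ-graded left `R`-module (grading `ℳ`).  Fix `k : ℤ` and suppose the degree-`k`
component of `M` decomposes as a direct sum `T ⊕ N` of `𝒜 0`-submodules, where `T` is
precisely the `𝒜 0`-torsion submodule (elements killed by some non-zero-divisor of `𝒜 0`).
Assume for every `x ∈ N` and `y ∈ T` there are `d : ℤ` and a homogeneous `z ∈ 𝒜 d` with
`z • x' = 0` for all `x' ∈ N` and such that multiplication by `z` is injective on the cyclic
`𝒜 0`-submodule generated by `y`.  Then every grading-preserving `R`-linear endomorphism of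
`M` preserves the decomposition in degree `k`.
-/
theorem graded_endomorphism_preserves_decomposition
    (R : Type*) [Ring R] (𝒜 : ℤ → AddSubgroup R) [GradedRing 𝒜]
    (hcomm : ∀ a ∈ 𝒜 0, ∀ b ∈ 𝒜 0, a * b = b * a)
    (M : Type*) [AddCommGroup M] [Module R M]
    (ℳ : ℤ → AddSubgroup M)
    (hM : DirectSum.IsInternal ℳ)
    (hgrsmul : ∀ (i j : ℤ) (r : R), r ∈ 𝒜 i → ∀ m ∈ ℳ j, r • m ∈ ℳ (i + j))
    (k : ℤ)
    (T N : AddSubgroup M)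
    (hTk : T ≤ ℳ k) (hNk : N ≤ ℳ k)
    (hTsmul : ∀ r ∈ 𝒜 0, ∀ m ∈ T, r • m ∈ T)
    (hNsmul : ∀ r ∈ 𝒜 0, ∀ m ∈ N, r • m ∈ N)
    -- `ℳ k = T ⊕ N` :
    (hsum : ∀ m ∈ ℳ k, ∃ t ∈ T, ∃ x ∈ N, m = t + x)
    (hdisj : ∀ m ∈ T, m ∈ N → m = 0)
    -- `T` is precisely the `𝒜 0`-torsion of `ℳ k` :
    (hT : ∀ m : M, m ∈ T ↔ m ∈ ℳ k ∧ ∃ r ∈ 𝒜 0,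
        (∀ s ∈ 𝒜 0, r * s = 0 → s = 0) ∧ r • m = 0)
    -- the key hypothesis on the existence of suitable homogeneous elements `z` :
    (hz : ∀ x ∈ N, ∀ y ∈ T, ∃ (d : ℤ) (z : R), z ∈ 𝒜 d ∧
        (∀ x' ∈ N, z • x' = 0) ∧
        (∀ r ∈ 𝒜 0, z • (r • y) = 0 → r • y = 0))
    -- `F` is an `R`-linear grading-preserving endomorphism of `M` :
    (F : M →ₗ[R] M)
    (hF : ∀ (j : ℤ), ∀ m ∈ ℳ j, F m ∈ ℳ j) :
    (∀ t ∈ T, F t ∈ T) ∧ (∀ x ∈ N, F x ∈ N) := by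
  constructor
  · intro t ht
    obtain ⟨htk, r, hr, hreg, hrt⟩ := (hT t).1 ht
    exact (hT (F t)).2 ⟨hF k t htk, r, hr, hreg, by rw [← map_smul, hrt, map_zero]⟩
  · intro x hx
    obtain ⟨t, ht, n, hn, hFx⟩ := hsum (F x) (hF k x (hNk hx))
    obtain ⟨d, z, -, hzN, hzt⟩ := hz x hx t ht
    have hzero : z • t = 0 := by
      have h : z • F x = 0 := by rw [← map_smul, hzN x hx, map_zero]
      rwa [hFx, smul_add, hzN n hn, add_zero] at h
    have ht0 : t = 0 := by
      simpa [hzero] using hzt 1 SetLike.GradedOne.one_mem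
    rwa [hFx, ht0, zero_add]
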